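/- arXiv:1209.5614 — 2 statements merged into one kernel-verified Lean document; each statement's English description precedes it below -/
import Mathlib

section
/- Let H be an m-multigraph on n vertices with at least one edge, m ≥ 2. Then there exists a Z-eigenpair (λ*, x*) of the adjacency tensor A_H with λ* > 0 and every coordinate of x* nonnegative, such that λ* = max{ A_H x^m : x ∈ ℝ^n, Σ_{i=1}^n x_i^2 = 1 } = max{ A_H x^m : x ∈ ℝ^n, x_i ≥ 0 for all i, Σ_{i=1}^n x_i^2 = 1 }, and moreover |μ| ≤ λ* for every Z-eigenvalue μ of A_H (i.e., λ* equals the Z-spectral radius of A_H). -/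
open Finset

noncomputable section

/-- Prepend the vertex `i` to the `(m-1)`-tuple `j`, producing an `m`-tuple
`(i, j 0, j 1, ...)` of indices. -/
def consVec {n m : ℕ} (i : Fin n) (j : Fin (m - 1) → Fin n) : Fin m → Fin n :=
  fun t => if h : (t : ℕ) = 0 then i else j ⟨(t : ℕ) - 1, by have := t.isLt; omega⟩

/-- The `i`-th entry of the vector `A x^{m-1}`:
`∑_{i_2,…,i_m} a_{i i_2 … i_m} x_{i_2} ⋯ x_{i_m}` (real version). -/
def tContract {n m : ℕ} (A : (Fin m → Fin n) → ℝ) (x : Fin n → ℝ) (i : Fin n) : ℝ :=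
  ∑ j : Fin (m - 1) → Fin n, A (consVec i j) * ∏ t, x (j t)

/-- The `i`-th entry of the vector `A x^{m-1}` (complex vector, real tensor). -/
def tContractC {n m : ℕ} (A : (Fin m → Fin n) → ℝ) (x : Fin n → ℂ) (i : Fin n) : ℂ :=
  ∑ j : Fin (m - 1) → Fin n, (A (consVec i j) : ℂ) * ∏ t, x (j t)

/-- The scalar `A x^m = ∑_{i_1,…,i_m} a_{i_1 … i_m} x_{i_1} ⋯ x_{i_m}`. -/
def tForm {n m : ℕ} (A : (Fin m → Fin n) → ℝ) (x : Fin n → ℝ) : ℝ :=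
  ∑ j : Fin m → Fin n, A j * ∏ t, x (j t)

/-- The adjacency tensor of an `m`-multigraph on `n` vertices whose edge multiset is `E`:
the entry at `(i_1,…,i_m)` is `1/(m-1)!` if the multiset `{i_1,…,i_m}` is an edge, else `0`. -/
def adjT (n m : ℕ) (E : Multiset (Multiset (Fin n))) : (Fin m → Fin n) → ℝ :=
  fun j => if (↑(List.ofFn j) : Multiset (Fin n)) ∈ E then
    1 / (Nat.factorial (m - 1) : ℝ) else 0

/-- The adjacency tensor of an `m`-graph on `n` vertices whose edge set is `E`:
the entry at `(i_1,…,i_m)` is `1/(m-1)!` if `i_1,…,i_m` are pairwise distinct and the set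
`{i_1,…,i_m}` is an edge, else `0`. -/
def adjTG (n m : ℕ) (E : Finset (Finset (Fin n))) : (Fin m → Fin n) → ℝ :=
  fun j => if (List.ofFn j).Nodup ∧ (List.ofFn j).toFinset ∈ E then
    1 / (Nat.factorial (m - 1) : ℝ) else 0

/-- Degree of a vertex in a multi-hypergraph: the number of edges containing it
(counted with multiplicity). -/
def degM {n : ℕ} (E : Multiset (Multiset (Fin n))) (v : Fin n) : ℕ :=
  Multiset.card (E.filter (fun e => v ∈ e))

/-- Degree of a vertex in a hypergraph: the number of edges containing it. -/
def degG {n : ℕ} (E : Finset (Finset (Fin n))) (v : Fin n) : ℕ :=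
  (E.filter (fun e => v ∈ e)).card

/-- A multi-hypergraph is connected iff every pair of vertices is joined by a chain
`(x_1, E_1, x_2, E_2, …, E_q, x_{q+1})` with `x_1,…,x_q` distinct vertices,
`E_1,…,E_q` distinct edges, and `x_k, x_{k+1} ∈ E_k` for all `k`. -/
def IsConnectedM {n : ℕ} (E : Multiset (Multiset (Fin n))) : Prop :=
  ∀ u v : Fin n, ∃ (q : ℕ) (x : Fin (q + 1) → Fin n) (ed : Fin q → Multiset (Fin n)),
    x 0 = u ∧ x (Fin.last q) = v ∧
    (∀ k1 k2 : Fin q, k1 ≠ k2 → x k1.castSucc ≠ x k2.castSucc) ∧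
    (∀ k1 k2 : Fin q, k1 ≠ k2 → ed k1 ≠ ed k2) ∧
    (∀ k : Fin q, ed k ∈ E) ∧
    (∀ k : Fin q, x k.castSucc ∈ ed k ∧ x k.succ ∈ ed k)

/-- A nonnegative tensor is weakly irreducible iff its associated directed graph
(with an arc `i → j` whenever `a_{i i_2 … i_m} > 0` for some `i_2,…,i_m` with
`j ∈ {i_2,…,i_m}`) is strongly connected. -/
def WeaklyIrreducible {n m : ℕ} (A : (Fin m → Fin n) → ℝ) : Prop :=
  ∀ i j : Fin n, Relation.ReflTransGen
    (fun a b => ∃ v : Fin (m - 1) → Fin n, (∃ t, v t = b) ∧ 0 < A (consVec a v)) i j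

/-- An `m`-multigraph is nicely-connected iff there is no nonempty proper vertex subset `V₀`
such that no edge has the form `{i, i_2, …, i_m}` with `i ∈ V₀` and `i_2, …, i_m ∉ V₀`. -/
def NicelyConnectedM (n m : ℕ) (E : Multiset (Multiset (Fin n))) : Prop :=
  ¬ ∃ V0 : Finset (Fin n), V0.Nonempty ∧ V0 ≠ Finset.univ ∧
      ∀ (i : Fin n) (j : Fin (m - 1) → Fin n), i ∈ V0 → (∀ t, j t ∉ V0) →
        (i ::ₘ (↑(List.ofFn j) : Multiset (Fin n))) ∉ E

/-- An `m`-graph is nicely-connected iff there is no nonempty vertex subset `V₀` with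
`|V₀| ≤ n - m + 1` such that no edge has the form `{i, i_2, …, i_m}` with `i ∈ V₀` and
`i_2, …, i_m ∉ V₀`. -/
def NicelyConnectedG (n m : ℕ) (E : Finset (Finset (Fin n))) : Prop :=
  ¬ ∃ V0 : Finset (Fin n), V0.Nonempty ∧ V0.card ≤ n - m + 1 ∧
      ∀ (i : Fin n) (j : Fin (m - 1) → Fin n), i ∈ V0 → (∀ t, j t ∉ V0) →
        insert i (List.ofFn j).toFinset ∉ E

/-- A tensor is irreducible iff there is no nonempty proper index subset `I` with
`a_{i_1 i_2 … i_m} = 0` for all `i_1 ∈ I` and `i_2, …, i_m ∉ I`. -/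
def TIrreducible {n m : ℕ} (A : (Fin m → Fin n) → ℝ) : Prop :=
  ¬ ∃ I : Finset (Fin n), I.Nonempty ∧ I ≠ Finset.univ ∧
      ∀ (i : Fin n) (j : Fin (m - 1) → Fin n), i ∈ I → (∀ t, j t ∉ I) →
        A (consVec i j) = 0
theorem consVec_succ {n k : ℕ} (i : Fin n) (j : Fin k → Fin n) :
    consVec (m := k + 1) i j = Fin.cons i j := by
  funext t
  refine Fin.cases ?_ (fun s => ?_) t
  · simp [consVec]
  · simp [consVec]

theorem sum_mul_tContract {n k : ℕ} (A : (Fin (k + 1) → Fin n) → ℝ) (x v : Fin n → ℝ) :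
    ∑ i, v i * tContract A x i =
      ∑ j : Fin (k + 1) → Fin n, A j * (v (j 0) * ∏ t : Fin k, x (j t.succ)) := by
  rw [← (Fin.consEquiv fun _ : Fin (k + 1) => Fin n).sum_comp, Fintype.sum_prod_type]
  refine Finset.sum_congr rfl fun i _ => ?_
  simp only [tContract, Finset.mul_sum]
  refine Finset.sum_congr rfl fun j _ => ?_
  rw [consVec_succ]
  simp only [Fin.consEquiv, Equiv.coe_fn_mk, Fin.cons_zero, Fin.cons_succ]
  exact mul_left_comm _ _ _

theorem sum_self_mul_tContract {n k : ℕ} (A : (Fin (k + 1) → Fin n) → ℝ) (x : Fin n → ℝ) :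
    ∑ i, x i * tContract A x i = tForm A x := by
  rw [sum_mul_tContract]
  simp only [tForm, Fin.prod_univ_succ]

theorem tForm_smul {n m : ℕ} (A : (Fin m → Fin n) → ℝ) (c : ℝ) (x : Fin n → ℝ) :
    tForm A (fun i => c * x i) = c ^ m * tForm A x := by
  simp only [tForm, Finset.prod_mul_distrib, Finset.mul_sum, Finset.prod_const,
    Finset.card_univ, Fintype.card_fin]
  exact Finset.sum_congr rfl fun j _ => mul_left_comm _ _ _

theorem abs_tForm_le {n m : ℕ} (A : (Fin m → Fin n) → ℝ) (hA : ∀ j, 0 ≤ A j)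
    (x : Fin n → ℝ) : |tForm A x| ≤ tForm A fun i => |x i| := by
  refine (Finset.abs_sum_le_sum_abs _ _).trans_eq ?_
  simp only [tForm, abs_mul, Finset.abs_prod, abs_of_nonneg (hA _)]

theorem continuous_tForm {n m : ℕ} (A : (Fin m → Fin n) → ℝ) : Continuous (tForm A) := by
  unfold tForm
  fun_prop

/-- The derivative of the form of a symmetric tensor along a line. -/
theorem hasDerivAt_tForm_line {n k : ℕ} (A : (Fin (k + 1) → Fin n) → ℝ)
    (hA : ∀ (σ : Equiv.Perm (Fin (k + 1))) j, A (j ∘ σ) = A j) (x v : Fin n → ℝ) :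
    HasDerivAt (fun s : ℝ => tForm A fun i => x i + s * v i)
      ((k + 1 : ℕ) * ∑ i, v i * tContract A x i) 0 := by
  have h : HasDerivAt (fun s : ℝ => tForm A fun i => x i + s * v i)
      (∑ j : Fin (k + 1) → Fin n, A j *
        ∑ t, (∏ u ∈ Finset.univ.erase t, (x (j u) + 0 * v (j u))) • v (j t)) 0 := by
    unfold tForm
    refine HasDerivAt.fun_sum fun j _ => HasDerivAt.const_mul _ ?_
    refine HasDerivAt.fun_finsetProd fun t _ => ?_
    simpa using ((hasDerivAt_id (0 : ℝ)).mul_const (v (j t))).const_add (x (j t))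
  convert h using 1
  simp only [zero_mul, add_zero, smul_eq_mul, Finset.mul_sum]
  rw [Finset.sum_comm, ← Finset.mul_sum, sum_mul_tContract, ← nsmul_eq_mul]
  refine ((Finset.sum_eq_card_nsmul fun t _ => ?_).trans (by rw [Finset.card_fin])).symm
  rw [← (Equiv.arrowCongr (Equiv.swap 0 t) (Equiv.refl (Fin n))).sum_comp]
  refine Finset.sum_congr rfl fun j _ => ?_
  have e : (Equiv.arrowCongr (Equiv.swap 0 t) (Equiv.refl (Fin n))) j = j ∘ Equiv.swap 0 t := by
    funext u
    simp [Equiv.arrowCongr]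
  rw [e, hA, mul_comm (v (j 0))]
  simp only [Function.comp_apply, Equiv.swap_apply_right]
  congr 2
  have hp : ∏ u : Fin k, x (j u.succ) = ∏ u ∈ Finset.univ.erase 0, x (j u) := by
    rw [Fin.univ_succ, Finset.erase_cons, Finset.prod_map]
    rfl
  rw [hp]
  refine Finset.prod_equiv (Equiv.swap 0 t) (fun u => ?_) (fun _ _ => rfl)
  simp only [Finset.mem_erase, Finset.mem_univ, and_true]
  rw [not_iff_not, ← Equiv.apply_eq_iff_eq (Equiv.swap 0 t), Equiv.swap_apply_right]

/-- A form bounded by `c` on the unit sphere is bounded by `c ‖y‖ ^ m`. -/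
theorem tForm_le_mul_sqrt_pow {n m : ℕ} (A : (Fin m → Fin n) → ℝ) {c : ℝ}
    (hc : ∀ y : Fin n → ℝ, ∑ i, y i ^ 2 = 1 → tForm A y ≤ c) (y : Fin n → ℝ)
    (hy : 0 < ∑ i, y i ^ 2) : tForm A y ≤ c * √(∑ i, y i ^ 2) ^ m := by
  set r := √(∑ i, y i ^ 2)
  have hr0 : 0 < r := Real.sqrt_pos.mpr hy
  have hr2 : r ^ 2 = ∑ i, y i ^ 2 := Real.sq_sqrt hy.le
  have h := hc (fun i => r⁻¹ * y i) (by
    simp only [mul_pow, ← Finset.mul_sum, ← hr2]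
    field_simp)
  rw [tForm_smul, inv_pow, inv_mul_le_iff₀ (pow_pos hr0 m)] at h
  linarith

/-- A maximizer of a symmetric form on the unit sphere is a Z-eigenvector. -/
theorem tContract_eq_of_forall_tForm_le {n k : ℕ} (A : (Fin (k + 1) → Fin n) → ℝ)
    (hA : ∀ (σ : Equiv.Perm (Fin (k + 1))) j, A (j ∘ σ) = A j) (x : Fin n → ℝ)
    (hx : ∑ i, x i ^ 2 = 1)
    (hmax : ∀ y : Fin n → ℝ, ∑ i, y i ^ 2 = 1 → tForm A y ≤ tForm A x) (i : Fin n) :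
    tContract A x i = tForm A x * x i := by
  set w : Fin n → ℝ := fun i => tContract A x i - tForm A x * x i with hw
  have hwx : ∑ i, w i * x i = 0 := by
    have := sum_self_mul_tContract A x
    calc ∑ i, w i * x i = ∑ i, x i * tContract A x i - tForm A x * ∑ i, x i ^ 2 := by
          rw [Finset.mul_sum, ← Finset.sum_sub_distrib]
          exact Finset.sum_congr rfl fun i _ => by simp only [hw]; ring
      _ = 0 := by rw [this, hx]; ring
  have hsq : ∀ s : ℝ, ∑ i, (x i + s * w i) ^ 2 = 1 + s ^ 2 * ∑ i, w i ^ 2 := fun s => by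
    calc ∑ i, (x i + s * w i) ^ 2
        = ∑ i, x i ^ 2 + 2 * s * ∑ i, w i * x i + s ^ 2 * ∑ i, w i ^ 2 := by
          rw [Finset.mul_sum, Finset.mul_sum, ← Finset.sum_add_distrib,
            ← Finset.sum_add_distrib]
          exact Finset.sum_congr rfl fun i _ => by ring
      _ = _ := by rw [hx, hwx]; ring
  have hww : ∑ i, w i * tContract A x i = ∑ i, w i ^ 2 := by
    calc ∑ i, w i * tContract A x i
        = ∑ i, w i ^ 2 + tForm A x * ∑ i, w i * x i := by
          rw [Finset.mul_sum, ← Finset.sum_add_distrib]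
          exact Finset.sum_congr rfl fun i _ => by simp only [hw]; ring
      _ = _ := by rw [hwx]; ring
  set W := ∑ i, w i ^ 2
  have hW0 : 0 ≤ W := Finset.sum_nonneg fun i _ => sq_nonneg _
  have hd1 := hasDerivAt_tForm_line A hA x w
  have hd2 : HasDerivAt (fun s : ℝ => tForm A x * √(1 + s ^ 2 * W) ^ (k + 1)) 0 0 := by
    have h0 : HasDerivAt (fun s : ℝ => 1 + s ^ 2 * W) 0 0 := by
      simpa using (((hasDerivAt_id (0 : ℝ)).pow 2).mul_const W).const_add 1
    simpa using ((h0.sqrt (by norm_num)).pow (k + 1)).const_mul (tForm A x)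
  have hlm : IsLocalMax (fun s : ℝ => (tForm A fun i => x i + s * w i) -
      tForm A x * √(1 + s ^ 2 * W) ^ (k + 1)) 0 := by
    refine Filter.Eventually.of_forall fun s => ?_
    have := tForm_le_mul_sqrt_pow A hmax (fun i => x i + s * w i) (by
      rw [hsq]; positivity)
    rw [hsq] at this
    simpa using this
  have hzero := hlm.hasDerivAt_eq_zero (hd1.sub hd2)
  rw [hww, sub_zero] at hzero
  have hWz : W = 0 := (mul_eq_zero.mp hzero).resolve_left (by positivity)
  have := (Finset.sum_eq_zero_iff_of_nonneg fun i _ => sq_nonneg (w i)).mp hWz i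
    (Finset.mem_univ i)
  exact sub_eq_zero.mp (pow_eq_zero_iff two_ne_zero |>.mp this)

theorem isCompact_setOf_sum_sq_eq_one (n : ℕ) :
    IsCompact {y : Fin n → ℝ | ∑ i, y i ^ 2 = 1} := by
  have hbox := isCompact_univ_pi fun _ : Fin n => isCompact_Icc (a := (-1 : ℝ)) (b := 1)
  refine hbox.of_isClosed_subset
    (isClosed_eq (by fun_prop) continuous_const) fun y hy i _ => ?_
  have hy : ∑ i, y i ^ 2 = 1 := hy
  have := Finset.single_le_sum (f := fun i => y i ^ 2) (fun i _ => sq_nonneg (y i))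
    (Finset.mem_univ i)
  exact abs_le.mp (abs_le_one_iff_mul_self_le_one.mpr (by simp only [hy] at this; nlinarith))

theorem adjT_comp_perm {n m : ℕ} (E : Multiset (Multiset (Fin n))) (σ : Equiv.Perm (Fin m))
    (j : Fin m → Fin n) : adjT n m E (j ∘ σ) = adjT n m E j := by
  have : (↑(List.ofFn (j ∘ σ)) : Multiset (Fin n)) = ↑(List.ofFn j) :=
    Multiset.coe_eq_coe.mpr (Equiv.Perm.ofFn_comp_perm σ j)
  simp only [adjT, this]

theorem adjT_nonneg {n m : ℕ} (E : Multiset (Multiset (Fin n))) (j : Fin m → Fin n) :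
    0 ≤ adjT n m E j := by
  unfold adjT
  split_ifs <;> positivity

theorem exists_adjT_pos {n m : ℕ} {E : Multiset (Multiset (Fin n))}
    (hE : ∀ e ∈ E, Multiset.card e = m) (hne : E ≠ 0) : ∃ j, 0 < adjT n m E j := by
  obtain ⟨e, he⟩ := Multiset.exists_mem_of_ne_zero hne
  obtain ⟨l, rfl⟩ := Quot.exists_rep e
  obtain rfl : l.length = m := hE _ he
  refine ⟨l.get, ?_⟩
  rw [adjT, if_pos (by rw [List.ofFn_get]; exact he)]
  positivity

/-- An m-multigraph with at least one edge has a Z-eigenpair (λ*, x*) with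
λ* > 0, x* ≥ 0, λ* = max of A_H x^m over the unit sphere (with or without the
nonnegativity restriction), and |μ| ≤ λ* for every Z-eigenvalue μ. -/
theorem stmt3 (n m : ℕ) (hm : 2 ≤ m) (E : Multiset (Multiset (Fin n)))
    (hE : ∀ e ∈ E, Multiset.card e = m) (hne : E ≠ 0) :
    ∃ (lam : ℝ) (x : Fin n → ℝ), 0 < lam ∧ (∀ i, 0 ≤ x i) ∧
      (∀ i, tContract (adjT n m E) x i = lam * x i) ∧ (∑ i, (x i) ^ 2 = 1) ∧
      IsGreatest {r : ℝ | ∃ y : Fin n → ℝ, (∑ i, (y i) ^ 2 = 1) ∧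
        tForm (adjT n m E) y = r} lam ∧
      IsGreatest {r : ℝ | ∃ y : Fin n → ℝ, (∀ i, 0 ≤ y i) ∧ (∑ i, (y i) ^ 2 = 1) ∧
        tForm (adjT n m E) y = r} lam ∧
      (∀ (mu : ℝ) (z : Fin n → ℝ), (∀ i, tContract (adjT n m E) z i = mu * z i) →
        (∑ i, (z i) ^ 2 = 1) → |mu| ≤ lam) := by
  obtain ⟨k, rfl⟩ : ∃ k, m = k + 1 := ⟨m - 1, by omega⟩
  set A := adjT n (k + 1) E
  have hA0 : ∀ j, 0 ≤ A j := adjT_nonneg E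
  obtain ⟨j₀, hj₀⟩ : ∃ j, 0 < A j := exists_adjT_pos hE hne
  have hn : (0 : ℝ) < n := Nat.cast_pos.mpr (j₀ 0).pos
  set u : Fin n → ℝ := fun _ => √(n : ℝ)⁻¹ with hu
  have hu1 : ∑ i, u i ^ 2 = 1 := by
    simp only [hu, Real.sq_sqrt (inv_nonneg.mpr hn.le), Finset.sum_const, Finset.card_univ,
      Fintype.card_fin, nsmul_eq_mul]
    exact mul_inv_cancel₀ hn.ne'
  have hupos : 0 < tForm A u := by
    refine Finset.sum_pos' (fun j _ => mul_nonneg (hA0 j) (by positivity))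
      ⟨j₀, Finset.mem_univ _, mul_pos hj₀ ?_⟩
    exact Finset.prod_pos fun _ _ => Real.sqrt_pos.mpr (inv_pos.mpr hn)
  obtain ⟨y, hy1, hy⟩ := (isCompact_setOf_sum_sq_eq_one n).exists_isMaxOn ⟨u, hu1⟩
    (continuous_tForm A).continuousOn
  have hx1 : ∑ i, |y i| ^ 2 = 1 := by
    simp only [sq_abs]
    exact hy1
  have hmax : ∀ z : Fin n → ℝ, ∑ i, z i ^ 2 = 1 → tForm A z ≤ tForm A fun i => |y i| :=
    fun z hz => (hy hz).trans ((le_abs_self _).trans (abs_tForm_le A hA0 y))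
  refine ⟨tForm A fun i => |y i|, fun i => |y i|, hupos.trans_le (hmax u hu1),
    fun i => abs_nonneg _,
    tContract_eq_of_forall_tForm_le A (adjT_comp_perm E) _ hx1 hmax, hx1,
    ⟨⟨_, hx1, rfl⟩, ?_⟩, ⟨⟨_, fun i => abs_nonneg _, hx1, rfl⟩, ?_⟩, fun mu z hz hz1 => ?_⟩
  · rintro _ ⟨z, hz, rfl⟩
    exact hmax z hz
  · rintro _ ⟨z, -, hz, rfl⟩
    exact hmax z hz
  · have hmu : tForm A z = mu := by
      rw [← sum_self_mul_tContract]
      calc ∑ i, z i * tContract A z i = mu * ∑ i, z i ^ 2 := by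
            rw [Finset.mul_sum]
            exact Finset.sum_congr rfl fun i _ => by rw [hz]; ring
        _ = mu := by rw [hz1, mul_one]
    rw [← hmu]
    exact (abs_tForm_le A hA0 z).trans (hmax _ (by simpa only [sq_abs] using hz1))
end
end

section
/- Let H be an m-graph on n vertices, and suppose either that m is odd, or that m is even and H is m-partite. If the set of E-eigenvalues of the adjacency tensor A_H is finite, then the sum of all E-eigenvalues of A_H is zero. -/
open Finset

noncomputable section

theorem prod_consVec {M : Type*} [CommMonoid M] {n m : ℕ} (hm : m ≠ 0) (f : Fin n → M)
    (i : Fin n) (j : Fin (m - 1) → Fin n) :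
    ∏ t, f (consVec i j t) = f i * ∏ t, f (j t) := by
  obtain ⟨k, rfl⟩ := Nat.exists_eq_succ_of_ne_zero hm
  rw [Fin.prod_univ_succ]
  rfl

/-- A sign change of the coordinates whose product over every index tuple in the support of the
tensor is `-1` negates `A x^{m-1}` up to the same sign change. -/
theorem tContractC_sign_mul {n m : ℕ} (hm : m ≠ 0) (A : (Fin m → Fin n) → ℝ) (s : Fin n → ℂ)
    (hs : ∀ i, s i ^ 2 = 1) (hA : ∀ k, A k ≠ 0 → ∏ t, s (k t) = -1) (x : Fin n → ℂ)
    (i : Fin n) :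
    tContractC A (fun v => s v * x v) i = -(s i * tContractC A x i) := by
  unfold tContractC
  rw [Finset.mul_sum, ← Finset.sum_neg_distrib]
  refine Finset.sum_congr rfl fun j _ => ?_
  by_cases h : A (consVec i j) = 0
  · simp [h]
  · have hprod := hA _ h
    rw [prod_consVec hm] at hprod
    rw [Finset.prod_mul_distrib]
    linear_combination (A (consVec i j) : ℂ) * (∏ t, x (j t)) *
      (s i * hprod - (∏ t, s (j t)) * hs i)

/-- In an `m`-graph with `m` odd, or `m`-partite with `m` even, there is
a choice of signs on the vertices whose product over every edge is `-1`. -/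
theorem exists_sign_prod_edge_eq_neg_one {n m : ℕ} (hm : m ≠ 0) (E : Finset (Finset (Fin n)))
    (hE : ∀ e ∈ E, e.card = m)
    (hcase : Odd m ∨ (Even m ∧ ∃ P : Fin n → Fin m, ∀ e ∈ E, ∀ p : Fin m,
      (e.filter (fun v => P v = p)).card = 1)) :
    ∃ s : Fin n → ℂ, (∀ i, s i ^ 2 = 1) ∧ ∀ e ∈ E, ∏ v ∈ e, s v = -1 := by
  rcases hcase with hodd | ⟨-, P, hP⟩
  · exact ⟨fun _ => -1, by simp, fun e he => by simp [hE e he, hodd.neg_one_pow]⟩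
  · refine ⟨fun v => if P v = ⟨0, Nat.pos_of_ne_zero hm⟩ then -1 else 1, fun i => ?_,
      fun e he => ?_⟩
    · dsimp only
      split_ifs <;> norm_num
    · simp [Finset.prod_ite, hP e he]

theorem prod_eq_of_adjTG_ne_zero {n m : ℕ} {E : Finset (Finset (Fin n))} {s : Fin n → ℂ} {c : ℂ}
    (hs : ∀ e ∈ E, ∏ v ∈ e, s v = c) (k : Fin m → Fin n) (hk : adjTG n m E k ≠ 0) :
    ∏ t, s (k t) = c := by
  have h : (List.ofFn k).Nodup ∧ (List.ofFn k).toFinset ∈ E := by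
    by_contra h
    exact hk (if_neg h)
  rw [← hs _ h.2, List.prod_toFinset _ h.1, List.map_ofFn, List.prod_ofFn]
  rfl

/-- For an m-graph with m odd, or an m-partite m-graph with m even, if the set
of E-eigenvalues of A_H is finite then the sum of all E-eigenvalues is zero. -/
theorem stmt12 (n m : ℕ) (hm : 2 ≤ m) (E : Finset (Finset (Fin n)))
    (hE : ∀ e ∈ E, e.card = m)
    (hcase : Odd m ∨ (Even m ∧ ∃ P : Fin n → Fin m, ∀ e ∈ E, ∀ p : Fin m,
      (e.filter (fun v => P v = p)).card = 1))
    (hfin : {lam : ℂ | ∃ x : Fin n → ℂ, x ≠ 0 ∧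
      (∀ i, tContractC (adjTG n m E) x i = lam * x i) ∧ ∑ i, (x i) ^ 2 = 1}.Finite) :
    ∑ lam ∈ hfin.toFinset, lam = 0 := by
  have hm0 : m ≠ 0 := by omega
  obtain ⟨s, hs, hsE⟩ := exists_sign_prod_edge_eq_neg_one hm0 E hE hcase
  refine Finset.sum_involution (fun lam _ => -lam) (fun lam _ => add_neg_cancel lam)
    (fun lam _ h => neg_ne_self.mpr h) (fun lam h => ?_) (fun lam _ => neg_neg lam)
  rw [Set.Finite.mem_toFinset] at h ⊢
  obtain ⟨x, hx, hlam, hnorm⟩ := h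
  refine ⟨fun v => s v * x v, fun h0 => hx (funext fun v => ?_), fun i => ?_, ?_⟩
  · have hv : s v * x v = 0 := congrFun h0 v
    exact (mul_eq_zero.mp hv).resolve_left fun h => by simpa [h] using hs v
  · rw [tContractC_sign_mul hm0 _ s hs (prod_eq_of_adjTG_ne_zero hsE), hlam]
    ring
  · simpa [mul_pow, hs] using hnorm
end
end
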